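/- Let x, y, z, z' > 0 with z ≤ z' and z' ≥ max(x, y, z). Then for every finite universe U, the rational set similarity S_{x,y,z,z'} on subsets of U is LSHable: there exists a probability distribution (PMF) over functions h : 𝒫(U) → ℕ such that Pr_h[h(A) = h(B)] = S_{x,y,z,z'}(A,B) for all A, B ⊆ U. -/

import Mathlib

open Filter Topology

namespace RatSimAux

/-- The kernel of a hash function. -/
noncomputable def ker {X : Type*} (h : X → ℕ) : X → X → ℝ :=
  fun A B => if h A = h B then 1 else 0

/-- The polytope of LSHable similarities. -/
noncomputable def K (X : Type*) : Set (X → X → ℝ) := convexHull ℝ (Set.range (ker (X := X)))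

lemma ker_mem {X : Type*} (h : X → ℕ) : ker h ∈ K X := subset_convexHull _ _ ⟨h, rfl⟩

lemma one_mem (X : Type*) : (fun _ _ => 1 : X → X → ℝ) ∈ K X := by
  have h : ker (fun _ : X => 0) = fun _ _ => 1 := by funext A B; simp [ker]
  exact h ▸ ker_mem (X := X) (fun _ => 0)

lemma isClosed_K (X : Type*) [Finite X] : IsClosed (K X) := by
  have hf : (Set.range (ker (X := X))).Finite := by
    apply (Set.finite_range (fun (g : X → X → Bool) => fun A B => if g A B then (1 : ℝ) else 0)).subset
    rintro _ ⟨h, rfl⟩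
    exact ⟨fun A B => decide (h A = h B), by funext A B; simp [ker]⟩
  exact (hf.isCompact_convexHull (𝕜 := ℝ)).isClosed

/-- Gluing two kernels along a predicate. -/
noncomputable def glue {X : Type*} (p : X → Prop) [DecidablePred p] :
    ((X → X → ℝ) × (X → X → ℝ)) →ₗ[ℝ] (X → X → ℝ) where
  toFun S := fun A B => (if p A ∧ p B then S.1 A B else 0) + (if ¬ p A ∧ ¬ p B then S.2 A B else 0)
  map_add' S T := by
    funext A B
    by_cases hA : p A <;> by_cases hB : p B <;> simp [hA, hB]
  map_smul' c S := by
    funext A B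
    by_cases hA : p A <;> by_cases hB : p B <;> simp [hA, hB]

lemma glue_mem {X : Type*} (p : X → Prop) [DecidablePred p] {S T : X → X → ℝ}
    (hS : S ∈ K X) (hT : T ∈ K X) : glue p (S, T) ∈ K X := by
  have h1 : (S, T) ∈ convexHull ℝ (Set.range (ker (X := X)) ×ˢ Set.range (ker (X := X))) := by
    rw [convexHull_prod]; exact ⟨hS, hT⟩
  have h2 := Set.mem_image_of_mem (glue p) h1
  rw [LinearMap.image_convexHull] at h2
  refine convexHull_mono ?_ h2
  rintro _ ⟨⟨_, _⟩, ⟨⟨f, rfl⟩, ⟨g, rfl⟩⟩, rfl⟩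
  refine ⟨fun A => if p A then 2 * f A else 2 * g A + 1, ?_⟩
  funext A B
  by_cases hA : p A <;> by_cases hB : p B <;> simp [hA, hB, glue, ker] <;> omega

lemma exists_pmf {X : Type*} {S : X → X → ℝ} (hS : S ∈ K X) :
    ∃ μ : PMF (X → ℕ), ∀ A B : X,
      μ.toOuterMeasure {h : X → ℕ | h A = h B} = ENNReal.ofReal (S A B) := by
  classical
  rw [K, mem_convexHull_iff_exists_fintype] at hS
  obtain ⟨ι, _, w, k, hw, hw1, hk, rfl⟩ := hS
  choose h hh using hk
  refine ⟨(PMF.ofFintype (fun i => ENNReal.ofReal (w i)) ?_).map h, fun A B => ?_⟩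
  · rw [← ENNReal.ofReal_sum_of_nonneg (fun i _ => hw i), hw1, ENNReal.ofReal_one]
  · rw [PMF.toOuterMeasure_map_apply, PMF.toOuterMeasure_apply_fintype]
    simp only [Finset.sum_apply, Pi.smul_apply, smul_eq_mul]
    refine Eq.trans ?_ (ENNReal.ofReal_sum_of_nonneg ?_).symm
    · refine Finset.sum_congr rfl fun i _ => ?_
      rw [← hh i]
      by_cases hi : h i A = h i B <;> simp [ker, hi, Set.indicator]
    · intro i _
      rw [← hh i]
      exact mul_nonneg (hw i) (by unfold ker; split_ifs <;> norm_num)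

/-- One round of the process. -/
noncomputable def step {U : Type*} [Fintype U] [DecidableEq U] (a b : ℝ)
    (S : Finset U → Finset U → ℝ) : Finset U → Finset U → ℝ :=
  ∑ u : U, ((Fintype.card U : ℝ)⁻¹) • glue (fun A : Finset U => u ∈ A)
    (a • (fun _ _ => 1) + (1 - a) • S, b • (fun _ _ => 1) + (1 - b) • S)

lemma step_mem {U : Type*} [Fintype U] [DecidableEq U] [Nonempty U] {a b : ℝ}
    (ha : 0 ≤ a) (ha1 : a ≤ 1) (hb : 0 ≤ b) (hb1 : b ≤ 1)
    {S : Finset U → Finset U → ℝ} (hS : S ∈ K (Finset U)) : step a b S ∈ K (Finset U) := by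
  have hc : Convex ℝ (K (Finset U)) := convex_convexHull _ _
  refine hc.sum_mem (fun _ _ => by positivity) (by simp) fun u _ => glue_mem _ ?_ ?_
  · exact hc (one_mem _) hS ha (by linarith) (by ring)
  · exact hc (one_mem _) hS hb (by linarith) (by ring)

lemma step_apply {U : Type*} [Fintype U] [DecidableEq U] (a b : ℝ)
    (S : Finset U → Finset U → ℝ) (A B : Finset U) :
    step a b S A B = (Fintype.card U : ℝ)⁻¹ *
      (((A ∩ B).card : ℝ) * (a + (1 - a) * S A B) +
        (((A ∪ B)ᶜ : Finset U).card : ℝ) * (b + (1 - b) * S A B)) := by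
  have h1 : A ∩ B = Finset.univ.filter (fun u => u ∈ A ∧ u ∈ B) := by ext; simp
  have h2 : (A ∪ B)ᶜ = Finset.univ.filter (fun u => u ∉ A ∧ u ∉ B) := by ext; simp
  rw [h1, h2]
  simp only [step, Finset.sum_apply, Pi.smul_apply, smul_eq_mul, ← Finset.mul_sum]
  simp only [glue, LinearMap.coe_mk, AddHom.coe_mk, Finset.sum_add_distrib, ← Finset.sum_filter]
  simp
  left
  ring

lemma card_split {U : Type*} [Fintype U] [DecidableEq U] (A B : Finset U) :
    (Fintype.card U : ℝ) = ((A ∩ B).card : ℝ) + (((A ∪ B)ᶜ : Finset U).card : ℝ)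
      + ((symmDiff A B).card : ℝ) := by
  have h1 : A ∩ B = Finset.univ.filter (fun u => u ∈ A ∧ u ∈ B) := by ext; simp
  have h2 : (A ∪ B)ᶜ = Finset.univ.filter (fun u => u ∉ A ∧ u ∉ B) := by ext; simp
  have h3 : symmDiff A B = Finset.univ.filter (fun u => (u ∈ A ∧ u ∉ B) ∨ (u ∈ B ∧ u ∉ A)) := by
    ext; simp [Finset.mem_symmDiff]
  rw [h1, h2, h3]
  simp only [← Finset.sum_boole, ← Finset.sum_add_distrib]
  rw [← Finset.card_univ, Finset.cast_card]
  refine Finset.sum_congr rfl fun u _ => ?_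
  by_cases hA : u ∈ A <;> by_cases hB : u ∈ B <;> simp [hA, hB]

lemma seq_tendsto {a b p q d : ℝ} (ha : 0 < a) (ha1 : a ≤ 1) (hb : 0 < b) (hb1 : b ≤ 1)
    (hp : 0 ≤ p) (hq : 0 ≤ q) (hd : 0 ≤ d) (hn : 0 < p + q + d) (f : ℕ → ℝ) (h0 : f 0 = 1)
    (hf : ∀ k, f (k + 1) = (p + q + d)⁻¹ * (p * (a + (1 - a) * f k) + q * (b + (1 - b) * f k))) :
    Tendsto f atTop (𝓝 ((a * p + b * q) / (a * p + b * q + d))) := by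
  have hap : 0 ≤ a * p := by positivity
  have hbq : 0 ≤ b * q := by positivity
  have hD : 0 < a * p + b * q + d := by
    rcases hp.eq_or_lt with h | h
    · rcases hq.eq_or_lt with h' | h'
      · linarith
      · have : 0 < b * q := by positivity
        linarith
    · have : 0 < a * p := by positivity
      linarith
  set L := (a * p + b * q) / (a * p + b * q + d) with hL
  have hLD : L * (a * p + b * q + d) = a * p + b * q := div_mul_cancel₀ _ hD.ne'
  set r := (p + q + d)⁻¹ * (p * (1 - a) + q * (1 - b)) with hr
  have hr0 : 0 ≤ r := mul_nonneg (by positivity)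
    (add_nonneg (mul_nonneg hp (by linarith)) (mul_nonneg hq (by linarith)))
  have hr1 : r < 1 := by
    rw [hr, inv_mul_lt_iff₀ hn]; linarith
  have hk : ∀ k, f k = L + r ^ k * (1 - L) := by
    intro k
    induction k with
    | zero => rw [h0]; ring
    | succ k ih =>
      have e : (p + q + d)⁻¹ * (a * p + b * q) = (1 - r) * L := by
        rw [hr]; field_simp; linarith
      calc f (k + 1) = (p + q + d)⁻¹ * (a * p + b * q) + r * f k := by rw [hf, hr]; ring
        _ = _ := by rw [e, ih]; ring
  have ht := ((tendsto_pow_atTop_nhds_zero_of_lt_one hr0 hr1).mul_const (1 - L)).const_add L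
  rw [zero_mul, add_zero] at ht
  exact ht.congr fun k => (hk k).symm

lemma base_mem {U : Type*} [Fintype U] [DecidableEq U] [Nonempty U] {a b : ℝ}
    (ha : 0 < a) (ha1 : a ≤ 1) (hb : 0 < b) (hb1 : b ≤ 1) :
    (fun A B : Finset U => (a * ((A ∩ B).card : ℝ) + b * (((A ∪ B)ᶜ : Finset U).card : ℝ)) /
      (a * ((A ∩ B).card : ℝ) + b * (((A ∪ B)ᶜ : Finset U).card : ℝ)
        + ((symmDiff A B).card : ℝ))) ∈ K (Finset U) := by
  have hmem : ∀ k : ℕ, (step a b)^[k] (fun _ _ => 1) ∈ K (Finset U) := by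
    intro k
    induction k with
    | zero => exact one_mem _
    | succ k ih =>
      rw [Function.iterate_succ_apply']
      exact step_mem ha.le ha1 hb.le hb1 ih
  refine (isClosed_K _).mem_of_tendsto (b := atTop) ?_ (Eventually.of_forall hmem)
  rw [tendsto_pi_nhds]; intro A
  rw [tendsto_pi_nhds]; intro B
  have hn : (0 : ℝ) < Fintype.card U := by exact_mod_cast Fintype.card_pos
  have hs := card_split A B
  have hit : ∀ k : ℕ, (step a b)^[k + 1] (fun _ _ => 1) A B = (Fintype.card U : ℝ)⁻¹ *
      (((A ∩ B).card : ℝ) * (a + (1 - a) * (step a b)^[k] (fun _ _ => 1) A B) +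
        (((A ∪ B)ᶜ : Finset U).card : ℝ) * (b + (1 - b) * (step a b)^[k] (fun _ _ => 1) A B)) := by
    intro k
    rw [Function.iterate_succ_apply', step_apply]
  have h0 : (step a b)^[0] (fun _ _ => 1) A B = 1 := rfl
  rw [hs] at hit hn
  exact seq_tendsto ha ha1 hb hb1 (Nat.cast_nonneg _) (Nat.cast_nonneg _) (Nat.cast_nonneg _) hn
    (fun k => (step a b)^[k] (fun _ _ => 1) A B) h0 hit

end RatSimAux

/-- The rational set similarity `S_{x,y,z,z'}` of `A, B ⊆ U` for a finite universe `U`: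
`N(A,B)/D(A,B)` where `N(A,B) = x|A∩B| + y|U∖(A∪B)| + z|A△B|` and
`D(A,B) = x|A∩B| + y|U∖(A∪B)| + z'|A△B|`, with value `1` when `D(A,B) = 0`. -/
noncomputable def ratSim {U : Type*} [Fintype U] [DecidableEq U]
    (x y z z' : ℝ) (A B : Finset U) : ℝ :=
  if x * ((A ∩ B).card : ℝ) + y * (((A ∪ B)ᶜ : Finset U).card : ℝ)
      + z' * ((symmDiff A B).card : ℝ) = 0 then 1
  else (x * ((A ∩ B).card : ℝ) + y * (((A ∪ B)ᶜ : Finset U).card : ℝ)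
      + z * ((symmDiff A B).card : ℝ))
    / (x * ((A ∩ B).card : ℝ) + y * (((A ∪ B)ᶜ : Finset U).card : ℝ)
      + z' * ((symmDiff A B).card : ℝ))

/-- if `x, y, z, z' > 0`, `z ≤ z'` and `z' ≥ max(x,y,z)`, then for every
finite universe `U` the rational set similarity `S_{x,y,z,z'}` is LSHable: there is a
PMF over hash functions `h : 𝒫(U) → ℕ` with `Pr_h[h A = h B] = S_{x,y,z,z'}(A,B)`. -/
theorem ratSim_LSHable
    (x y z z' : ℝ) (hx : 0 < x) (hy : 0 < y) (hz : 0 < z) (hz' : 0 < z')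
    (hzz' : z ≤ z') (hmax : max (max x y) z ≤ z')
    (U : Type*) [Fintype U] [DecidableEq U] :
    ∃ μ : PMF (Finset U → ℕ), ∀ A B : Finset U,
      μ.toOuterMeasure {h : Finset U → ℕ | h A = h B}
        = ENNReal.ofReal (ratSim x y z z' A B) := by
  apply RatSimAux.exists_pmf (S := ratSim x y z z')
  have hxz : x ≤ z' := le_trans (le_trans (le_max_left _ _) (le_max_left _ _)) hmax
  have hyz : y ≤ z' := le_trans (le_trans (le_max_right _ _) (le_max_left _ _)) hmax
  rcases isEmpty_or_nonempty U with hU | hU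
  · have h : ratSim x y z z' = fun (_ _ : Finset U) => (1 : ℝ) := by
      funext A B
      rw [Subsingleton.elim A ∅, Subsingleton.elim B ∅]
      simp [ratSim]
    rw [h]
    exact RatSimAux.one_mem _
  have hc : Convex ℝ (RatSimAux.K (Finset U)) := convex_convexHull _ _
  have hbase := RatSimAux.base_mem (U := U) (div_pos hx hz') ((div_le_one hz').2 hxz)
    (div_pos hy hz') ((div_le_one hz').2 hyz)
  have hmix := hc (RatSimAux.one_mem _) hbase (div_pos hz hz').le
    (sub_nonneg.2 ((div_le_one hz').2 hzz')) (by ring)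
  convert hmix using 1
  funext A B
  have hs := RatSimAux.card_split A B
  have hn : (0 : ℝ) < Fintype.card U := by exact_mod_cast Fintype.card_pos
  simp only [ratSim, Pi.add_apply, Pi.smul_apply, smul_eq_mul]
  rw [hs] at hn
  have hp : (0 : ℝ) ≤ ((A ∩ B).card : ℝ) := Nat.cast_nonneg _
  have hq : (0 : ℝ) ≤ (((A ∪ B)ᶜ : Finset U).card : ℝ) := Nat.cast_nonneg _
  have hd : (0 : ℝ) ≤ ((symmDiff A B).card : ℝ) := Nat.cast_nonneg _
  generalize ((A ∩ B).card : ℝ) = p at *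
  generalize (((A ∪ B)ᶜ : Finset U).card : ℝ) = q at *
  generalize ((symmDiff A B).card : ℝ) = d at *
  have hD : 0 < x * p + y * q + z' * d := by
    have h1 : 0 ≤ x * p := by positivity
    have h2 : 0 ≤ y * q := by positivity
    have h3 : 0 ≤ z' * d := by positivity
    by_contra hneg
    have e1 : x * p = 0 := by linarith
    have e2 : y * q = 0 := by linarith
    have e3 : z' * d = 0 := by linarith
    simp only [mul_eq_zero, hx.ne', hy.ne', hz'.ne', false_or] at e1 e2 e3
    linarith
  have hne := hD.ne'
  rw [if_neg hne]
  have e : x / z' * p + y / z' * q = (x * p + y * q) / z' := by ring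
  have e2 : (x * p + y * q) / z' + d = (x * p + y * q + z' * d) / z' := by field_simp
  rw [e, e2, div_div_div_cancel_right₀ hz'.ne']
  rw [div_eq_iff hne, add_mul, mul_assoc (1 - z / z'), div_mul_cancel₀ _ hne]
  field_simp
  ring
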